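/- If X is a compact Hausdorff topological space that is homogeneous and has countable tightness, then the weight of X is at most 2^ℵ₀; that is, there exists a basis for the topology of X of cardinality at most the continuum. -/

import Mathlib

open Cardinal Topology

theorem Cardinal.mk_range_le_continuum {A : Type*} {B : Type*} (f : A → B) (h : #A ≤ 𝔠) :
    #(Set.range f) ≤ 𝔠 := by
  have h1 := Cardinal.mk_range_le_lift (f := f)
  rw [← Cardinal.lift_le_continuum]
  exact h1.trans (Cardinal.lift_le_continuum.2 h)

theorem Cardinal.mk_prod_le_continuum {A B : Type*} (hA : #A ≤ 𝔠) (hB : #B ≤ 𝔠) :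
    #(A × B) ≤ 𝔠 := by
  rw [Cardinal.mk_prod, ← Cardinal.continuum_mul_self]
  exact mul_le_mul' (Cardinal.lift_le_continuum.2 hA) (Cardinal.lift_le_continuum.2 hB)

theorem Cardinal.mk_list_le_continuum {A : Type*} (hA : #A ≤ 𝔠) : #(List A) ≤ 𝔠 :=
  (Cardinal.mk_list_le_max A).trans (max_le Cardinal.aleph0_le_continuum hA)

theorem WType.cardinalMk_le_continuum {α : Type} (hα : #α ≤ 𝔠) (D : α → Type)
    [∀ a, Countable (D a)] : #(WType D) ≤ 𝔠 := by
  refine WType.cardinalMk_le_of_le ?_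
  calc Cardinal.sum (fun a => 𝔠 ^ #(D a))
      ≤ Cardinal.sum fun _ : α => 𝔠 := Cardinal.sum_le_sum _ _ fun a =>
        (Cardinal.power_le_power_left Cardinal.continuum_ne_zero mk_le_aleph0).trans_eq
          Cardinal.continuum_power_aleph0
    _ = #α * 𝔠 := Cardinal.sum_const' _ _
    _ ≤ 𝔠 * 𝔠 := mul_le_mul_left hα 𝔠
    _ = 𝔠 := Cardinal.continuum_mul_self

section

variable {X : Type*} [TopologicalSpace X]

/-- In a regular space the closures of the subsets of `A` form a network for `closure A`. -/
theorem exists_closure_image_subset_of_mem_closure_range [RegularSpace X] {ι : Type*} {a : ι → X}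
    {x : X} (hx : x ∈ closure (Set.range a)) {U : Set X} (hU : U ∈ 𝓝 x) :
    ∃ s : Set ι, x ∈ closure (a '' s) ∧ closure (a '' s) ⊆ U := by
  obtain ⟨V, hV, hVc, hVU⟩ := exists_mem_nhds_isClosed_subset hU
  refine ⟨a ⁻¹' V, ?_, (closure_minimal (Set.image_preimage_subset a V) hVc).trans hVU⟩
  rw [Set.image_preimage_eq_inter_range, Set.inter_comm]
  rw [mem_closure_iff_nhds] at hx ⊢
  intro t ht
  obtain ⟨y, hy, hya⟩ := hx (t ∩ V) (Filter.inter_mem ht hV)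
  exact ⟨y, hy.1, hya, hy.2⟩

/-- A compact Hausdorff space with a closed network of cardinality at most the continuum has
weight at most the continuum. -/
theorem exists_isTopologicalBasis_mk_le_continuum_of_network [CompactSpace X] [T2Space X]
    {K : Type} (hK : #K ≤ 𝔠) (C : K → Set X) (hC : ∀ k, IsClosed (C k))
    (hnet : ∀ (x : X) (U : Set X), U ∈ 𝓝 x → ∃ k, x ∈ C k ∧ C k ⊆ U) :
    ∃ B : Set (Set X), TopologicalSpace.IsTopologicalBasis B ∧ #B ≤ 𝔠 := by
  have hsep : ∀ p : K × K, ∃ V W : Set X, IsOpen V ∧ IsOpen W ∧ Disjoint V W ∧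
      (Disjoint (C p.1) (C p.2) → C p.1 ⊆ V ∧ C p.2 ⊆ W) := by
    intro p
    by_cases h : Disjoint (C p.1) (C p.2)
    · obtain ⟨V, W, hV, hW, h1, h2, h3⟩ := normal_separation (hC p.1) (hC p.2) h
      exact ⟨V, W, hV, hW, h3, fun _ => ⟨h1, h2⟩⟩
    · exact ⟨∅, ∅, isOpen_empty, isOpen_empty, disjoint_bot_left, fun h' => absurd h' h⟩
  choose V W hV hW hVW hCVW using hsep
  refine ⟨Set.range fun t : List (K × K) => ⋂ p ∈ {p | p ∈ t}, V p, ?_,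
    mk_range_le_continuum _ (mk_list_le_continuum (mk_prod_le_continuum hK hK))⟩
  refine TopologicalSpace.isTopologicalBasis_of_isOpen_of_nhds ?_ ?_
  · rintro _ ⟨t, rfl⟩
    exact (List.finite_toSet t).isOpen_biInter fun p _ => hV p
  · intro x U hxU hU
    have hpt : ∀ y ∈ Uᶜ, ∃ p, x ∈ V p ∧ y ∈ W p := by
      intro y hy
      have hxy : x ≠ y := fun h => hy (h ▸ hxU)
      obtain ⟨S, T, hS, hT, hxS, hyT, hST⟩ := t2_separation hxy
      obtain ⟨k, hxk, hk⟩ := hnet x S (hS.mem_nhds hxS)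
      obtain ⟨l, hyl, hl⟩ := hnet y T (hT.mem_nhds hyT)
      obtain ⟨h1, h2⟩ := hCVW (k, l) (hST.mono hk hl)
      exact ⟨(k, l), h1 hxk, h2 hyl⟩
    obtain ⟨t, ht⟩ := hU.isClosed_compl.isCompact.elim_finite_subcover
      (fun p : {p // x ∈ V p} => W p) (fun p => hW p) (by
        intro y hy
        obtain ⟨p, hp, hyp⟩ := hpt y hy
        exact Set.mem_iUnion.2 ⟨⟨p, hp⟩, hyp⟩)
    refine ⟨_, ⟨t.toList.map Subtype.val, rfl⟩, ?_, ?_⟩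
    · simp +contextual
    · intro z hz
      by_contra hzU
      obtain ⟨p, hp, hzp⟩ := Set.mem_iUnion₂.1 (ht hzU)
      refine (hVW p).le_bot ⟨?_, hzp⟩
      refine Set.mem_iInter₂.1 hz p.1 ?_
      simpa using ⟨p.2, hp⟩

/-- **Pytkeev's theorem**: in a countably tight compact Hausdorff space every cover by Gδ sets has
a subcover of cardinality at most the continuum. -/
theorem exists_subcover_mk_le_continuum_of_isGδ [CompactSpace X] [T2Space X]
    (tight : ∀ (A : Set X) (x : X), x ∈ closure A → ∃ B ⊆ A, B.Countable ∧ x ∈ closure B)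
    {ι : Type*} (G : ι → Set X) (hG : ∀ i, IsGδ (G i)) (hcov : ∀ x, ∃ i, x ∈ G i) :
    ∃ (K : Type) (j : K → ι), #K ≤ 𝔠 ∧ ∀ x, ∃ k, x ∈ G (j k) := by
  classical
  rcases isEmpty_or_nonempty X with hX | ⟨⟨x₀⟩⟩
  · exact ⟨Empty, Empty.elim, by simp, fun x => hX.elim x⟩
  obtain ⟨i₀, -⟩ := hcov x₀
  choose U hUo hGU using fun i => (hG i).eq_iInter_nat
  let g : (ℕ → X) → (ℕ → Set ℕ) → ι := fun a s =>
    if h : ∃ i, ⋂ n, closure (a '' s n) ⊆ G i then h.choose else i₀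
  have hg : ∀ (a : ℕ → X) (x : X), x ∈ closure (Set.range a) → ∃ s, x ∈ G (g a s) := by
    intro a x hx
    obtain ⟨i, hi⟩ := hcov x
    rw [hGU i, Set.mem_iInter] at hi
    choose s hxs hs using fun n =>
      exists_closure_image_subset_of_mem_closure_range hx ((hUo i n).mem_nhds (hi n))
    have h : ∃ i, ⋂ n, closure (a '' s n) ⊆ G i :=
      ⟨i, by rw [hGU i]; exact Set.iInter_mono hs⟩
    refine ⟨s, ?_⟩
    simp only [g, dif_pos h]
    exact h.choose_spec (Set.mem_iInter.2 hxs)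
  let R := ℕ → Set ℕ
  have hR : #R ≤ 𝔠 := by simp [R]
  let T := WType fun l : List (R × ℕ) => Fin l.length × ℕ
  have hT : #T ≤ 𝔠 := WType.cardinalMk_le_continuum
    (mk_list_le_continuum (mk_prod_le_continuum hR
      (mk_le_aleph0.trans aleph0_le_continuum))) _
  -- The union of open sets coded by a list of indices and a sequence of sequences of points.
  let O : (l : List (R × ℕ)) → (Fin l.length × ℕ → X) → Set X := fun l f =>
    ⋃ m : Fin l.length, U (g (fun n => f (m, n)) (l.get m).1) (l.get m).2
  let ev : T → X := WType.elim X fun p =>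
    if h : (O p.1 p.2)ᶜ.Nonempty then h.some else x₀
  have hev : ∀ l f, O l (fun d => ev (f d)) ≠ Set.univ →
      ev (WType.mk l f) ∉ O l (fun d => ev (f d)) := by
    intro l f h
    rw [← Set.nonempty_compl] at h
    have : ev (WType.mk l f) = h.some := dif_pos h
    rw [this]
    exact h.some_mem
  refine ⟨(ℕ → T) × R, fun k => g (fun n => ev (k.1 n)) k.2, mk_prod_le_continuum ?_ hR, ?_⟩
  · rw [← power_def, mk_nat, ← continuum_power_aleph0]
    exact power_le_power_right hT
  by_contra! hne
  obtain ⟨p, hp⟩ := hne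
  have hpt : ∀ y ∈ closure (Set.range ev), ∃ q : (ℕ → T) × R × ℕ,
      y ∈ U (g (fun n => ev (q.1 n)) q.2.1) q.2.2 ∧
      p ∉ U (g (fun n => ev (q.1 n)) q.2.1) q.2.2 := by
    intro y hy
    obtain ⟨B, hB, hBc, hyB⟩ := tight _ y hy
    obtain ⟨a, rfl⟩ := hBc.exists_eq_range (closure_nonempty_iff.1 ⟨y, hyB⟩)
    choose w hw using fun n => hB (Set.mem_range_self n)
    obtain rfl : (fun n => ev (w n)) = a := funext hw
    obtain ⟨s, hs⟩ := hg _ y hyB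
    have hps := hp (w, s)
    rw [hGU, Set.mem_iInter] at hs hps
    obtain ⟨n, hn⟩ := not_forall.1 hps
    exact ⟨(w, s, n), hs n, hn⟩
  obtain ⟨t, ht⟩ := isClosed_closure.isCompact.elim_finite_subcover
    (fun q : {q : (ℕ → T) × R × ℕ // p ∉ U (g (fun n => ev (q.1 n)) q.2.1) q.2.2} =>
      U (g (fun n => ev (q.1.1 n)) q.1.2.1) q.1.2.2) (fun q => hUo _ _) (by
      intro y hy
      obtain ⟨q, hq, hpq⟩ := hpt y hy
      exact Set.mem_iUnion.2 ⟨⟨q, hpq⟩, hq⟩)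
  let L := t.toList
  let l : List (R × ℕ) := L.map fun q => q.1.2
  have hlen : l.length = L.length := List.length_map _
  let f : Fin l.length × ℕ → T := fun d => (L.get (d.1.cast hlen)).1.1 d.2
  have hO : O l (fun d => ev (f d)) =
      ⋃ q ∈ t, U (g (fun n => ev (q.1.1 n)) q.1.2.1) q.1.2.2 := by
    ext z
    simp only [O, Set.mem_iUnion]
    constructor
    · rintro ⟨m, hm⟩
      refine ⟨L.get (m.cast hlen), Finset.mem_toList.1 (List.get_mem _ _), ?_⟩
      simpa [l, f] using hm
    · rintro ⟨q, hq, hz⟩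
      obtain ⟨m, rfl⟩ := List.mem_iff_get.1 (Finset.mem_toList.2 hq)
      refine ⟨m.cast hlen.symm, ?_⟩
      simpa [l, f] using hz
  have hpO : p ∉ O l (fun d => ev (f d)) := by
    rw [hO, Set.mem_iUnion₂]
    rintro ⟨q, -, hq⟩
    exact q.2 hq
  refine hev l f (fun h => hpO (h ▸ Set.mem_univ p)) ?_
  rw [hO]
  exact ht (subset_closure (Set.mem_range_self _))

/-- A nonempty countably tight compact Hausdorff space has a nonempty closed Gδ subset contained in
the closure of a countable set. -/
theorem exists_isGδ_subset_closure_countable [CompactSpace X] [T2Space X] [Nonempty X]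
    (tight : ∀ (A : Set X) (x : X), x ∈ closure A → ∃ B ⊆ A, B.Countable ∧ x ∈ closure B) :
    ∃ A H : Set X, A.Countable ∧ H.Nonempty ∧ IsGδ H ∧ H ⊆ closure A := by
  by_contra! hcon
  let P : Set X → Prop := fun H => IsClosed H ∧ IsGδ H ∧ H.Nonempty
  have hstep : ∀ A G : Set X, A.Countable → P G →
      ∃ H, P H ∧ H ⊆ G ∧ Disjoint H (closure A) := by
    intro A G hA hG
    obtain ⟨p, hpG, hpA⟩ := Set.not_subset.1 (hcon A G hA hG.2.2 hG.2.1)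
    obtain ⟨f, hf0, hf1, -⟩ := exists_continuous_zero_one_of_isClosed
      (isClosed_singleton (x := p)) (isClosed_closure (s := A)) (by simpa using hpA)
    have hcl : IsClosed (f ⁻¹' {0}) := isClosed_singleton.preimage f.continuous
    refine ⟨G ∩ f ⁻¹' {0}, ⟨hG.1.inter hcl, hG.2.1.inter ?_, p, hpG, hf0 rfl⟩,
      Set.inter_subset_left, ?_⟩
    · exact IsGδ.preimage f.continuous (isClosed_singleton (x := (0 : ℝ))).isGδ
    · rw [Set.disjoint_left]
      rintro y ⟨-, hy0⟩ hyA
      have h0 : f y = 0 := hy0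
      have h1 : f y = 1 := hf1 hyA
      exact zero_ne_one (h0.symm.trans h1)
  choose! step hstep using hstep
  have hpt : ∀ G : Set X, P G → ∃ x, x ∈ G := fun G hG => hG.2.2
  choose! pt hpt using hpt
  let Ω := (ℵ₁ : Cardinal.{0}).ord.ToType
  have hΩ : ∀ α : Ω, (Set.Iio α).Countable := fun α => by
    rw [← Cardinal.le_aleph0_iff_set_countable, ← Cardinal.lt_aleph_one_iff]
    simpa [Ω] using Cardinal.mk_Iio_lt α (by simp [Ω])
  have hΩu : Uncountable Ω := by
    rw [← Cardinal.aleph0_lt_mk_iff, Cardinal.mk_ord_toType]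
    exact Cardinal.aleph0_lt_aleph_one
  let F : Ω → Set X := (wellFounded_lt (α := Ω)).fix fun α rec =>
    step {x | ∃ β, ∃ h : β < α, x = pt (rec β h)} (⋂ β, ⋂ h : β < α, rec β h)
  let S : Ω → Set X := fun α => (fun β => pt (F β)) '' Set.Iio α
  have hF : ∀ α, F α = step (S α) (⋂ β ∈ Set.Iio α, F β) := by
    intro α
    have h1 : S α = {x | ∃ β, ∃ h : β < α, x = pt (F β)} := by
      ext x; simp [S, eq_comm]
    rw [h1]
    exact WellFounded.fix_eq _ _ α
  have hS : ∀ α, (S α).Countable := fun α => (hΩ α).image _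
  have hInter : ∀ α, (∀ β < α, P (F β) ∧ F β ⊆ ⋂ γ ∈ Set.Iio β, F γ) →
      P (⋂ β ∈ Set.Iio α, F β) := by
    intro α ih
    refine ⟨isClosed_biInter fun β hβ => (ih β hβ).1.1,
      IsGδ.biInter (hΩ α) fun β hβ => (ih β hβ).1.2.1, ?_⟩
    rcases (Set.Iio α).eq_empty_or_nonempty with h | h
    · simp [h]
    · have := h.to_subtype
      rw [Set.biInter_eq_iInter]
      refine IsCompact.nonempty_iInter_of_directed_nonempty_isCompact_isClosed _ ?_
        (fun β => (ih β β.2).1.2.2) (fun β => (ih β β.2).1.1.isCompact)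
        (fun β => (ih β β.2).1.1)
      refine directed_of_isDirected_le (fun β γ hβγ => ?_)
      rcases hβγ.eq_or_lt with rfl | hlt
      · exact le_rfl
      · exact (ih γ γ.2).2.trans (Set.biInter_subset_of_mem hlt)
  have hPF : ∀ α, P (F α) ∧ F α ⊆ ⋂ γ ∈ Set.Iio α, F γ := by
    intro α
    induction α using WellFoundedLT.induction with
    | ind α ih =>
      obtain ⟨h1, h2, -⟩ := hstep _ _ (hS α) (hInter α ih)
      rw [hF α]
      exact ⟨h1, h2⟩
  have hdisj : ∀ α, Disjoint (F α) (closure (S α)) := fun α => by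
    rw [hF α]
    exact (hstep _ _ (hS α) (hInter α fun β _ => hPF β)).2.2
  have hanti : Antitone F := by
    intro β γ hβγ
    rcases hβγ.eq_or_lt with rfl | hlt
    · exact le_rfl
    · exact (hPF γ).2.trans (Set.biInter_subset_of_mem hlt)
  have hbdd : ∀ x ∈ closure (Set.range fun β => pt (F β)), ∃ α, x ∈ closure (S α) := by
    intro x hx
    obtain ⟨B, hB, hBc, hxB⟩ := tight _ x hx
    obtain ⟨a, rfl⟩ := hBc.exists_eq_range (closure_nonempty_iff.1 ⟨x, hxB⟩)
    choose b hb using fun n => hB (Set.mem_range_self n)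
    obtain ⟨α, hα⟩ : ∃ α, α ∉ ⋃ n, Set.Iic (b n) := by
      by_contra! h
      refine not_countable (α := Ω) (Set.countable_univ_iff.1 ?_)
      rw [← Set.eq_univ_of_forall h]
      refine Set.countable_iUnion fun n => ?_
      rw [← Set.Iio_insert]
      exact (hΩ _).insert _
    refine ⟨α, closure_mono ?_ hxB⟩
    rintro _ ⟨n, rfl⟩
    refine ⟨b n, ?_, hb n⟩
    simp only [Set.mem_iUnion, Set.mem_Iic, not_exists, not_le] at hα
    exact hα n
  have hne : Nonempty Ω := inferInstance
  obtain ⟨q, hq⟩ := IsCompact.nonempty_iInter_of_directed_nonempty_isCompact_isClosed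
    (fun α => F α ∩ closure (Set.range fun β => pt (F β)))
    (directed_of_isDirected_le fun β γ h => Set.inter_subset_inter_left _ (hanti h))
    (fun α => ⟨_, hpt _ (hPF α).1, subset_closure (Set.mem_range_self α)⟩)
    (fun α => ((hPF α).1.1.inter isClosed_closure).isCompact)
    (fun α => (hPF α).1.1.inter isClosed_closure)
  rw [Set.mem_iInter] at hq
  obtain ⟨α, hα⟩ := hbdd q (hq hne.some).2
  exact (hdisj α).le_bot ⟨(hq α).1, hα⟩

end

/-- Countable tightness, homogeneity and compact Hausdorff imply w(X) ≤ 2^ℵ₀. -/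
theorem weight_le_continuum_of_compact_homogeneous_countably_tight
    (X : Type*) [TopologicalSpace X] [CompactSpace X] [T2Space X]
    (homog : ∀ x y : X, ∃ f : X ≃ₜ X, f x = y)
    (tight : ∀ (A : Set X) (x : X), x ∈ closure A →
      ∃ B ⊆ A, B.Countable ∧ x ∈ closure B) :
    ∃ B : Set (Set X), TopologicalSpace.IsTopologicalBasis B ∧
      Cardinal.mk B ≤ 2 ^ Cardinal.aleph0 := by
  rw [Cardinal.two_power_aleph0]
  rcases isEmpty_or_nonempty X with hX | hX
  · exact exists_isTopologicalBasis_mk_le_continuum_of_network (K := Empty) (by simp)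
      Empty.elim (fun k => k.elim) fun x => hX.elim x
  obtain ⟨A, H, hA, ⟨p, hp⟩, hH, hHA⟩ := exists_isGδ_subset_closure_countable tight
  obtain ⟨a, rfl⟩ := hA.exists_eq_range (closure_nonempty_iff.1 ⟨p, hHA hp⟩)
  choose f hf using fun x => homog x p
  obtain ⟨K, j, hK, hj⟩ := exists_subcover_mk_le_continuum_of_isGδ tight
    (fun x => f x ⁻¹' H) (fun x => hH.preimage (f x).continuous)
    (fun x => ⟨x, by simpa [hf x] using hp⟩)
  refine exists_isTopologicalBasis_mk_le_continuum_of_network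
    (K := K × Set ℕ) (Cardinal.mk_prod_le_continuum hK Cardinal.mk_set_nat.le)
    (fun k => closure (((f (j k.1)).symm ∘ a) '' k.2)) (fun _ => isClosed_closure) ?_
  intro x U hU
  obtain ⟨k, hk⟩ := hj x
  have hx : x ∈ closure (Set.range ((f (j k)).symm ∘ a)) := by
    rw [Set.range_comp, ← Homeomorph.image_closure]
    exact ⟨_, hHA hk, (f (j k)).symm_apply_apply x⟩
  obtain ⟨s, hs⟩ := exists_closure_image_subset_of_mem_closure_range hx hU
  exact ⟨(k, s), hs⟩
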